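/- Let P₁,…,P_K be sets of probability distributions on ℝ such that d_L := max_k sup_{p,p'∈P_k} d_KS(p,p') is strictly smaller than d_H := min_{k≠k'} inf_{p∈P_k,p'∈P_{k'}} d_KS(p,p'), and set Δ = d_H − d_L. Then for any d_th ∈ (d_L, d_H) and independent sequences of n i.i.d. samples x ∼ p ∈ P_k, x' ∼ p' ∈ P_k, x'' ∼ p'' ∈ P_{k'} with k ≠ k', the following hold with b = min{(d_th − d_L)²/2, (d_H − d_th)²/2, Δ²/8}: P(d_KS(x,x'') ≤ d_th) ≤ 4·e^{−bn}, P(d_KS(x,x') > d_th) ≤ 4·e^{−bn}, and P(d_KS(x,x') ≥ d_KS(x,x'')) ≤ 6·e^{−bn}. -/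

import Mathlib

open MeasureTheory
open scoped Classical

/-- Empirical c.d.f. of a sequence of `n` real samples. -/
noncomputable def empCDF {n : ℕ} (x : Fin n → ℝ) (a : ℝ) : ℝ :=
  (Finset.univ.filter fun i => x i ≤ a).card / (n : ℝ)

/-- KS distance between the empirical c.d.f.'s of two sequences. -/
noncomputable def ksDistSeq {n : ℕ} (x y : Fin n → ℝ) : ℝ :=
  ⨆ a : ℝ, |empCDF x a - empCDF y a|

/-- c.d.f. of a measure on ℝ. -/
noncomputable def cdfOf (p : Measure ℝ) (a : ℝ) : ℝ := (p (Set.Iic a)).toReal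

/-- KS distance between two distributions on ℝ. -/
noncomputable def ksDist (p q : Measure ℝ) : ℝ :=
  ⨆ a : ℝ, |cdfOf p a - cdfOf q a|

/-- The mass of the atom used in the change of measure. -/
noncomputable def tiltMass (s : ℝ) : ℝ := 2 * s * (3 + s) / (3 * (1 - s))

lemma tiltMass_nonneg {s : ℝ} (h0 : 0 ≤ s) (h1 : s < 1) : 0 ≤ tiltMass s := by
  have : 0 < 1 - s := by linarith
  unfold tiltMass
  positivity

lemma hasDerivAt_tiltMass {s : ℝ} (h1 : s < 1) :
    HasDerivAt tiltMass (16 / (6 * (1 - s) ^ 2) - 2 / 3) s := by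
  have h : (1 - s) ≠ 0 := by linarith
  have h3 : 3 * (1 - s) ≠ 0 := by positivity
  have := (((hasDerivAt_id s).const_mul 2).mul ((hasDerivAt_id s).const_add 3)).div
    (((hasDerivAt_id s).const_sub 1).const_mul 3) h3
  refine this.congr_deriv ?_
  simp only [id, Pi.mul_apply]
  field_simp
  ring

lemma discriminant_nonneg {s : ℝ} (h0 : 0 ≤ s) (h1 : s ≤ 1 / 2) :
    0 ≤ 20736+55296*s+50688*s^2-36864*s^3-190720*s^4-872704/3*s^5-719360/3*s^6-728320/9*s^7
      +365312/9*s^8+1399040/27*s^9+354304/27*s^10-243968/27*s^11-150784/27*s^12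
      -10240/27*s^13+5120/9*s^14 := by
  have hs : ∀ k : ℕ, s ^ (k + 1) ≤ s ^ k / 2 := fun k => by
    rw [pow_succ]
    nlinarith [pow_nonneg h0 k]
  have h2 := hs 1; have h3 := hs 2; have h4 := hs 3; have h5 := hs 4; have h6 := hs 5
  have h7 := hs 6; have h8 := hs 7; have h9 := hs 8; have h10 := hs 9; have h11 := hs 10
  have h12 := hs 11; have h13 := hs 12
  norm_num at h2 h3 h4 h5 h6 h7 h8 h9 h10 h11 h12 h13
  have : 0 ≤ s ^ 14 := by positivity
  have : 0 ≤ s ^ 13 := by positivity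
  have : 0 ≤ s ^ 12 := by positivity
  have : 0 ≤ s ^ 11 := by positivity
  have : 0 ≤ s ^ 10 := by positivity
  have : 0 ≤ s ^ 9 := by positivity
  have : 0 ≤ s ^ 8 := by positivity
  have : 0 ≤ s ^ 2 := by positivity
  linarith

lemma quadratic_nonneg {s t : ℝ} (h0 : 0 ≤ s) (h1 : s < 1) (ht : 0 < t) :
    0 ≤ (1-s)*(3888+2592*s+3024*s^2-288*s^3-432*s^4+432*s^6) * t^2
      + (-3888+5184*s+3024*s^2+7344*s^3+864*s^4-1968*s^5-384*s^6+1536*s^7+576*s^8) * t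
      + (972-1944*s+324*s^2+288*s^3+2916*s^4+2472*s^5-996*s^6-2544*s^7-1296*s^8-192*s^9) := by
  set A := (1-s)*(3888+2592*s+3024*s^2-288*s^3-432*s^4+432*s^6) with hA
  set B := -3888+5184*s+3024*s^2+7344*s^3+864*s^4-1968*s^5-384*s^6+1536*s^7+576*s^8 with hB
  set D := 972-1944*s+324*s^2+288*s^3+2916*s^4+2472*s^5-996*s^6-2544*s^7-1296*s^8-192*s^9 with hD
  have hs : ∀ k : ℕ, s ^ (k + 1) ≤ s ^ k := fun k => pow_le_pow_of_le_one h0 h1.le (by omega)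
  have hp : ∀ k : ℕ, 0 ≤ s ^ k := fun k => pow_nonneg h0 k
  have hApos : 0 < A := by
    have : 0 < 1 - s := by linarith
    have h2 : s ^ 3 ≤ s ^ 2 := hs 2
    have h3 : s ^ 4 ≤ s ^ 3 := hs 3
    have : 0 < 3888+2592*s+3024*s^2-288*s^3-432*s^4+432*s^6 := by
      linarith [hp 2, hp 6]
    positivity
  rcases le_total s (1 / 2) with h | h
  · have hdisc : 0 ≤ 4 * A * D - B ^ 2 := by
      have := mul_nonneg (mul_nonneg h0 (by norm_num : (0:ℝ) ≤ 243)) (discriminant_nonneg h0 h)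
      have e : 4 * A * D - B ^ 2 = 243 * s * (20736+55296*s+50688*s^2-36864*s^3-190720*s^4-872704/3*s^5-719360/3*s^6-728320/9*s^7
      +365312/9*s^8+1399040/27*s^9+354304/27*s^10-243968/27*s^11-150784/27*s^12
      -10240/27*s^13+5120/9*s^14) := by
        rw [hA, hB, hD]; ring
      rw [e]; linarith
    have : 0 ≤ 4 * A * (A * t ^ 2 + B * t + D) := by
      nlinarith [sq_nonneg (2 * A * t + B)]
    exact nonneg_of_mul_nonneg_right this (by positivity)
  · have hBn : 0 ≤ B := by
      have h2 : 1 / 4 ≤ s ^ 2 := by nlinarith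
      have h3 : 1 / 8 ≤ s ^ 3 := by nlinarith
      have h5 : s ^ 5 ≤ s ^ 3 := (hs 4).trans (hs 3)
      have h6 : s ^ 6 ≤ s ^ 3 := (hs 5).trans h5
      linarith [hp 4, hp 7, hp 8]
    have hDn : 0 ≤ D := by
      have e : D = (1 - s) * (972 - 972*s - 648*s^2 - 360*s^3 + 2556*s^4 + 5028*s^5 + 4032*s^6
          + 1488*s^7 + 192*s^8) := by
        rw [hD]; ring
      rw [e]
      refine mul_nonneg (by linarith) ?_
      nlinarith [hp 2, hp 3, hp 5, hp 6, hp 7, hp 8, hs 2, hs 3, sq_nonneg (s^2 - 1/4), sq_nonneg (s^2-s/2), sq_nonneg (s-1/2)]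
    positivity


/-- Exponential rate of the tilted likelihood ratio at a point where the empirical mass exceeds
the true mass `t` by `s`. -/
lemma two_mul_sq_le_tilt {s t : ℝ} (h0 : 0 ≤ s) (h1 : s < 1) (ht : 0 < t) :
    2 * s ^ 2 ≤ (t + s) * Real.log (1 + tiltMass s / t) - Real.log (1 + tiltMass s) := by
  set c' : ℝ → ℝ := fun x => 16 / (6 * (1 - x) ^ 2) - 2 / 3 with hc'
  set H : ℝ → ℝ := fun x => (t + x) * (Real.log (t + tiltMass x) - Real.log t)
    - Real.log (1 + tiltMass x) - 2 * x ^ 2 with hH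
  set H₁ : ℝ → ℝ := fun x => Real.log (t + tiltMass x) - Real.log t
    + (t + x) * (c' x / (t + tiltMass x)) - c' x / (1 + tiltMass x) - 4 * x with hH₁
  have hmem : ∀ x ∈ Set.Icc 0 s, 0 ≤ tiltMass x ∧ x < 1 := fun x hx =>
    ⟨tiltMass_nonneg hx.1 (by linarith [hx.2]), by linarith [hx.2]⟩
  have dH : ∀ x ∈ Set.Icc 0 s, HasDerivAt H (H₁ x) x := by
    intro x hx
    obtain ⟨hc, hx1⟩ := hmem x hx
    have d := hasDerivAt_tiltMass hx1
    have := ((((hasDerivAt_id x).const_add t).mul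
      (((d.const_add t).log (by positivity)).sub_const (Real.log t))).sub
      ((d.const_add 1).log (by positivity))).sub ((hasDerivAt_pow 2 x).const_mul 2)
    refine this.congr_deriv ?_
    simp only [hH₁, hc', id]
    ring
  set H₂ : ℝ → ℝ := fun x => 2 * (c' x / (t + tiltMass x))
    + (t + x) * ((16 / (3 * (1 - x) ^ 3) * (t + tiltMass x) - c' x * c' x) / (t + tiltMass x) ^ 2)
    - (16 / (3 * (1 - x) ^ 3) * (1 + tiltMass x) - c' x * c' x) / (1 + tiltMass x) ^ 2 - 4 with hH₂
  have dH₁ : ∀ x ∈ Set.Icc 0 s, HasDerivAt H₁ (H₂ x) x := by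
    intro x hx
    obtain ⟨hc, hx1⟩ := hmem x hx
    have d := hasDerivAt_tiltMass hx1
    have hx0 : 1 - x ≠ 0 := by linarith
    have d' : HasDerivAt c' (16 / (3 * (1 - x) ^ 3)) x := by
      have := ((hasDerivAt_const x (16 : ℝ)).div
        ((((hasDerivAt_id x).const_sub 1).pow 2).const_mul 6)
        (by simp only [id, Pi.pow_apply]; positivity)).sub_const (2 / 3)
      refine this.congr_deriv ?_
      simp only [id, Pi.pow_apply]
      field_simp
      ring
    have := ((((((d.const_add t).log (by positivity)).sub_const (Real.log t))).add
      (((hasDerivAt_id x).const_add t).mul (d'.div (d.const_add t) (by positivity)))).sub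
      (d'.div (d.const_add 1) (by positivity))).sub ((hasDerivAt_id x).const_mul 4)
    refine this.congr_deriv ?_
    simp only [hH₂, hc', id]
    simp only [Pi.div_apply]
    ring
  have H₂_nonneg : ∀ x ∈ Set.Icc 0 s, 0 ≤ H₂ x := by
    intro x hx
    obtain ⟨hc, hx1⟩ := hmem x hx
    have hr : 0 < 1 - x := by linarith
    have hx0 : 0 ≤ x := hx.1
    have e1 : t + tiltMass x = (3 * (1 - x) * t + 2 * x * (3 + x)) / (3 * (1 - x)) := by
      unfold tiltMass; field_simp
    have e2 : 1 + tiltMass x = (3 + 3 * x + 2 * x ^ 2) / (3 * (1 - x)) := by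
      unfold tiltMass; field_simp; ring
    have p1 : 0 < 3 * (1 - x) * t + 2 * x * (3 + x) := by positivity
    have p2 : 0 < 3 + 3 * x + 2 * x ^ 2 := by positivity
    have e : H₂ x = (((1-x)*(3888+2592*x+3024*x^2-288*x^3-432*x^4+432*x^6) * t^2
      + (-3888+5184*x+3024*x^2+7344*x^3+864*x^4-1968*x^5-384*x^6+1536*x^7+576*x^8) * t
      + (972-1944*x+324*x^2+288*x^3+2916*x^4+2472*x^5-996*x^6-2544*x^7-1296*x^8-192*x^9)) * x) /
        (3 * (1 - x) ^ 2 * (3 + 3 * x + 2 * x ^ 2) ^ 2 *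
          (3 * (1 - x) * t + 2 * x * (3 + x)) ^ 2) := by
      simp only [hH₂, hc', e1, e2]
      field_simp
      ring
    rw [e]
    have := quadratic_nonneg hx0 hx1 ht
    positivity
  have mono : ∀ f f' : ℝ → ℝ, (∀ x ∈ Set.Icc 0 s, HasDerivAt f (f' x) x) →
      (∀ x ∈ Set.Icc 0 s, 0 ≤ f' x) → f 0 = 0 → ∀ x ∈ Set.Icc 0 s, 0 ≤ f x := by
    intro f f' hf hf' hz x hx
    have := monotoneOn_of_hasDerivWithinAt_nonneg (convex_Icc 0 s)
      (fun y hy => (hf y hy).continuousAt.continuousWithinAt)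
      (fun y hy => (hf y (interior_subset hy)).hasDerivWithinAt)
      (fun y hy => hf' y (interior_subset hy))
    rw [← hz]
    exact this (Set.left_mem_Icc.2 h0) hx hx.1
  have c0 : tiltMass 0 = 0 := by simp [tiltMass]
  have H₁_nonneg := mono H₁ H₂ dH₁ H₂_nonneg (by
    simp only [hH₁, hc', c0]; field_simp; norm_num)
  have := mono H H₁ dH H₁_nonneg (by simp [hH, c0]) s (Set.right_mem_Icc.2 h0)
  have hc := tiltMass_nonneg h0 h1
  have el : Real.log (1 + tiltMass s / t) = Real.log (t + tiltMass s) - Real.log t := by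
    rw [← Real.log_div (by positivity) (by positivity)]
    congr 1
    field_simp
  rw [el]
  simp only [hH] at this
  linarith

lemma pi_withDensity_eq {ι α : Type*} [Fintype ι] [MeasurableSpace α] (μ : Measure α)
    [IsProbabilityMeasure μ] {g : α → ENNReal} (hg : Measurable g)
    [SigmaFinite (μ.withDensity g)] :
    Measure.pi (fun _ : ι => μ.withDensity g)
      = (Measure.pi fun _ : ι => μ).withDensity fun x => ∏ i, g (x i) := by
  refine Measure.pi_eq fun s hs => ?_
  rw [withDensity_apply _ (MeasurableSet.univ_pi hs), ← lintegral_indicator (.univ_pi hs)]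
  have hprod : (Set.univ.pi s).indicator (fun x : ι → α => ∏ i, g (x i))
      = fun x => ∏ i, (s i).indicator g (x i) := by
    ext x
    by_cases hx : x ∈ Set.univ.pi s
    · rw [Set.indicator_of_mem hx]
      exact Finset.prod_congr rfl fun i _ => (Set.indicator_of_mem (hx i (Set.mem_univ i)) g).symm
    · rw [Set.indicator_of_notMem hx]
      simp only [Set.mem_univ_pi, not_forall] at hx
      obtain ⟨i, hi⟩ := hx
      exact (Finset.prod_eq_zero (Finset.mem_univ i) (Set.indicator_of_notMem hi g)).symm
  have hm : ∀ i, Measurable ((s i).indicator g) := fun i => hg.indicator (hs i)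
  rw [hprod, ProbabilityTheory.lintegral_prod_eq_prod_lintegral_of_indepFun Finset.univ
    (fun i (x : ι → α) => (s i).indicator g (x i))
    (ProbabilityTheory.iIndepFun_pi fun i => (hm i).aemeasurable)
    (fun i => (hm i).comp (measurable_pi_apply i))]
  refine Finset.prod_congr rfl fun i _ => ?_
  rw [withDensity_apply _ (hs i), ← lintegral_indicator (hs i)]
  exact (measurePreserving_eval (fun _ : ι => μ) i).lintegral_comp (hm i)

/-- Adding an atom of mass `c` at `z` multiplies the probability of an event that only sees
which samples fall in `C`, and the values of the others, by the likelihood ratio. -/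
lemma mul_measure_pi_le_of_atom {ι α : Type*} [Fintype ι] [MeasurableSpace α] (p : Measure α)
    [IsProbabilityMeasure p] {C : Set α} (hC : MeasurableSet C) (hpC : p C ≠ 0) (z : α)
    {c : ENNReal} (hc : c ≠ ⊤) {E : Set (ι → α)} (hE : MeasurableSet E)
    (hinv : (fun x i => if x i ∈ C then z else x i) ⁻¹' E = E) {k : ENNReal}
    (hk : ∀ x ∈ E, k ≤ (1 + c / p C) ^ (Finset.univ.filter fun i => x i ∈ C).card) :
    k * Measure.pi (fun _ : ι => p) E ≤ Measure.pi (fun _ : ι => p + c • Measure.dirac z) E := by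
  set T : α → α := fun y => if y ∈ C then z else y with hT
  have hTm : Measurable T := Measurable.ite hC measurable_const measurable_id
  have ha : c / p C ≠ ⊤ := ENNReal.div_ne_top hc hpC
  set g : α → ENNReal := fun y => 1 + C.indicator (fun _ => c / p C) y with hg
  have hgm : Measurable g :=
    (measurable_const (a := (1 : ENNReal))).add
      ((measurable_const (a := c / p C)).indicator hC)
  have hr : p.withDensity g = p + (c / p C) • p.restrict C := by
    have : g = 1 + C.indicator (fun _ => c / p C) := rfl
    rw [this, withDensity_add_left measurable_one, withDensity_one, withDensity_indicator hC,
      withDensity_const]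
  have : IsFiniteMeasure (c • Measure.dirac z) := Measure.smul_finite _ hc
  have : IsFiniteMeasure ((c / p C) • p.restrict C) := Measure.smul_finite _ ha
  have : IsFiniteMeasure (p.withDensity g) := by rw [hr]; infer_instance
  have hmap : (p + c • Measure.dirac z).map T = (p.withDensity g).map T := by
    have hres : (p.restrict C).map T = p C • Measure.dirac z := by
      have : T =ᵐ[p.restrict C] fun _ => z := by
        filter_upwards [ae_restrict_mem hC] with y hy
        simp [hT, hy]
      rw [Measure.map_congr this, Measure.map_const, Measure.restrict_apply_univ]
    rw [hr, Measure.map_add _ _ hTm, Measure.map_add _ _ hTm, Measure.map_smul, Measure.map_smul,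
      hres, Measure.map_dirac' hTm, smul_smul, ENNReal.div_mul_cancel hpC (measure_ne_top p C)]
    simp [hT]
  have hinvar : ∀ (μ : Measure α) [IsFiniteMeasure μ],
      Measure.pi (fun _ : ι => μ) E = Measure.pi (fun _ : ι => μ.map T) E := by
    intro μ _
    rw [← Measure.pi_map_pi (fun _ => hTm.aemeasurable),
      Measure.map_apply (by fun_prop) hE, hinv]
  rw [hinvar (p + c • Measure.dirac z), hmap, ← hinvar, pi_withDensity_eq p hgm,
    withDensity_apply _ hE, ← setLIntegral_const]
  refine setLIntegral_mono' hE fun x hx => (hk x hx).trans_eq ?_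
  have : ∀ i, g (x i) = if x i ∈ C then 1 + c / p C else 1 := fun i => by
    by_cases h : x i ∈ C <;> simp [hg, h]
  simp only [this]
  rw [← Finset.prod_filter, Finset.prod_const]

lemma exp_le_likelihood_ratio {n N : ℕ} {s t : ℝ} (h0 : 0 ≤ s) (h1 : s < 1) (ht : 0 < t)
    (hN : n * (t + s) ≤ N) :
    Real.exp (2 * n * s ^ 2) * (1 + tiltMass s) ^ n ≤ (1 + tiltMass s / t) ^ N := by
  have hc := tiltMass_nonneg h0 h1
  have hl : 0 ≤ Real.log (1 + tiltMass s / t) :=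
    Real.log_nonneg (by linarith [div_nonneg hc ht.le])
  rw [← Real.exp_log (by positivity : 0 < (1 + tiltMass s / t) ^ N),
    ← Real.exp_log (by positivity : 0 < (1 + tiltMass s) ^ n), ← Real.exp_add, Real.log_pow,
    Real.log_pow]
  refine Real.exp_le_exp.2 ?_
  have h2 := mul_le_mul_of_nonneg_left (two_mul_sq_le_tilt h0 h1 ht) (Nat.cast_nonneg (α := ℝ) n)
  have h3 := mul_le_mul_of_nonneg_right hN hl
  linarith

lemma measurableSet_le_count {ι α : Type*} [Fintype ι] [MeasurableSpace α] {C : Set α}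
    (hC : MeasurableSet C) (r : ℝ) :
    MeasurableSet {x : ι → α | r ≤ (Finset.univ.filter fun i => x i ∈ C).card} := by
  have : (fun x : ι → α => ((Finset.univ.filter fun i => x i ∈ C).card : ℝ))
      = fun x => ∑ i, C.indicator (fun _ => (1 : ℝ)) (x i) := by
    ext x
    simp [Set.indicator_apply]
  refine measurableSet_le measurable_const ?_
  rw [this]
  exact Finset.measurable_sum _ fun i _ =>
    (measurable_const.indicator hC).comp (measurable_pi_apply i)

/-- One-sided Dvoretzky–Kiefer–Wolfowitz–Massart inequality over a finite chain of sets. -/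
theorem measure_exists_count_ge_le {α κ : Type*} [MeasurableSpace α] [LinearOrder κ]
    (p : Measure α) [IsProbabilityMeasure p] {C : κ → Set α} (hC : Antitone C)
    (hCm : ∀ a, MeasurableSet (C a)) (J : Finset κ) (n : ℕ) {s : ℝ} (h0 : 0 ≤ s) :
    Measure.pi (fun _ : Fin n => p) {x | ∃ a ∈ J,
        n * (p.real (C a) + s) ≤ (Finset.univ.filter fun i => x i ∈ C a).card}
      ≤ ENNReal.ofReal (Real.exp (-(2 * n * s ^ 2))) := by
  rcases Nat.eq_zero_or_pos n with rfl | hn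
  · simpa using prob_le_one
  have hn' : (0 : ℝ) < n := by exact_mod_cast hn
  set X : κ → Set (Fin n → α) := fun a =>
    {x | n * (p.real (C a) + s) ≤ (Finset.univ.filter fun i => x i ∈ C a).card} with hX
  have hXm : ∀ a, MeasurableSet (X a) := fun a => measurableSet_le_count (hCm a) _
  have hcard : ∀ a (x : Fin n → α),
      ((Finset.univ.filter fun i => x i ∈ C a).card : ℝ) ≤ n := fun a x => by
    exact_mod_cast (Finset.card_filter_le _ _).trans_eq (by simp)
  rcases h0.eq_or_lt with rfl | hs
  · simpa using prob_le_one
  set J' := J.filter fun a => p (C a) ≠ 0 with hJ'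
  have hnull : ∀ a, p (C a) = 0 → Measure.pi (fun _ : Fin n => p) (X a) = 0 := by
    intro a ha
    have hsub : X a ⊆ ⋃ i : Fin n, Function.eval i ⁻¹' C a := by
      intro x hx
      have hpos : (0 : ℝ) < (Finset.univ.filter fun i => x i ∈ C a).card :=
        lt_of_lt_of_le (by positivity) hx
      obtain ⟨i, hi⟩ := Finset.card_pos.1 (Nat.cast_pos.1 hpos)
      exact Set.mem_iUnion.2 ⟨i, (Finset.mem_filter.1 hi).2⟩
    refine measure_mono_null hsub (measure_iUnion_null fun i => ?_)
    rw [(measurePreserving_eval (fun _ : Fin n => p) i).measure_preimage (hCm a).nullMeasurableSet,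
      ha]
  have hsplit : {x | ∃ a ∈ J, x ∈ X a} ⊆ (⋃ a ∈ J.filter fun a => p (C a) = 0, X a)
      ∪ ⋃ a ∈ J', X a := by
    rintro x ⟨a, haJ, hx⟩
    by_cases ha : p (C a) = 0
    · exact Or.inl (Set.mem_biUnion (Finset.mem_filter.2 ⟨haJ, ha⟩) hx)
    · exact Or.inr (Set.mem_biUnion (Finset.mem_filter.2 ⟨haJ, ha⟩) hx)
  refine (measure_mono hsplit).trans ((measure_union_le _ _).trans ?_)
  have hz : Measure.pi (fun _ : Fin n => p) (⋃ a ∈ J.filter fun a => p (C a) = 0, X a) = 0 :=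
    (measure_biUnion_null_iff (Finset.countable_toSet _)).2 fun a ha =>
      hnull a (Finset.mem_filter.1 ha).2
  rw [hz, zero_add]
  have hF : ∀ a ∈ J', 0 < p.real (C a) := fun a ha =>
    ENNReal.toReal_pos (Finset.mem_filter.1 ha).2 (measure_ne_top _ _)
  by_cases h1 : s < 1
  swap
  · have : (⋃ a ∈ J', X a) = ∅ := by
      refine Set.eq_empty_iff_forall_notMem.2 fun x hx' => ?_
      obtain ⟨a, ha, hx⟩ := Set.mem_iUnion₂.1 hx'
      have h2 := hF a ha
      have h3 : (n : ℝ) * (p.real (C a) + s) ≤ n := hx.trans (hcard a x)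
      have : p.real (C a) + s ≤ 1 := by
        by_contra! h
        nlinarith
      linarith
    rw [this, measure_empty]
    exact zero_le
  rcases J'.eq_empty_or_nonempty with hJe | hJne
  · simp [hJe]
  obtain ⟨z, hz⟩ : ∃ z, ∀ a ∈ J', z ∈ C a := by
    obtain ⟨z, hz⟩ := nonempty_of_measure_ne_zero (Finset.mem_filter.1 (J'.max'_mem hJne)).2
    exact ⟨z, fun a ha => hC (J'.le_max' a ha) hz⟩
  set A : κ → Set (Fin n → α) := fun a => X a \ ⋃ a' ∈ J'.filter (· < a), X a' with hA
  have hAm : ∀ a, MeasurableSet (A a) := fun a =>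
    (hXm a).diff (Finset.measurableSet_biUnion _ fun a' _ => hXm a')
  have hcover : (⋃ a ∈ J', X a) ⊆ ⋃ a ∈ J', A a := by
    intro x hx
    simp only [Set.mem_iUnion, exists_prop] at hx
    obtain ⟨a₀, ha₀, hx₀⟩ := hx
    have hne : (J'.filter fun a => x ∈ X a).Nonempty := ⟨a₀, Finset.mem_filter.2 ⟨ha₀, hx₀⟩⟩
    obtain ⟨hm1, hm2⟩ := Finset.mem_filter.1 (Finset.min'_mem _ hne)
    refine Set.mem_biUnion hm1 ⟨hm2, fun h => ?_⟩
    simp only [Set.mem_iUnion, Finset.mem_filter, exists_prop] at h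
    obtain ⟨a', ⟨ha', hlt⟩, hx'⟩ := h
    exact absurd (Finset.min'_le _ a' (Finset.mem_filter.2 ⟨ha', hx'⟩)) (not_le.2 hlt)
  have hdisj : Set.PairwiseDisjoint (J' : Set κ) A := by
    have key : ∀ a ∈ J', ∀ b, a < b → Disjoint (A a) (A b) := fun a ha b hab =>
      Set.disjoint_left.2 fun x hxa hxb =>
        hxb.2 (Set.mem_biUnion (Finset.mem_filter.2 ⟨ha, hab⟩) hxa.1)
    intro a ha b hb hab
    rcases lt_or_gt_of_ne hab with h | h
    · exact key a ha b h
    · exact (key b hb a h).symm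
  set c := tiltMass s with hc
  have hc0 : 0 ≤ c := tiltMass_nonneg h0 h1
  set q := p + ENNReal.ofReal c • Measure.dirac z with hq
  have : IsFiniteMeasure (ENNReal.ofReal c • Measure.dirac z) :=
    Measure.smul_finite _ ENNReal.ofReal_ne_top
  have hkey : ∀ a ∈ J', ENNReal.ofReal (Real.exp (2 * n * s ^ 2) * (1 + c) ^ n)
      * Measure.pi (fun _ : Fin n => p) (A a) ≤ Measure.pi (fun _ : Fin n => q) (A a) := by
    intro a ha
    refine mul_measure_pi_le_of_atom p (hCm a) (Finset.mem_filter.1 ha).2 z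
      ENNReal.ofReal_ne_top (hAm a) ?_ ?_
    · have hinv : ∀ a' ∈ J', a' ≤ a → ∀ x : Fin n → α,
          (fun i => if x i ∈ C a then z else x i) ∈ X a' ↔ x ∈ X a' := by
        intro a' ha' hle x
        have : ∀ i, (if x i ∈ C a then z else x i) ∈ C a' ↔ x i ∈ C a' := fun i => by
          by_cases h : x i ∈ C a
          · simp [h, hz a' ha', hC hle h]
          · simp [h]
        simp only [hX, Set.mem_ofPred_eq, this]
      ext x
      simp only [hA, Set.mem_preimage, Set.mem_sdiff, Set.mem_iUnion, Finset.mem_filter,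
        exists_prop, hinv a ha le_rfl x]
      refine and_congr_right fun _ => not_congr (exists_congr fun a' => and_congr_right fun h => ?_)
      exact hinv a' h.1 h.2.le x
    · intro x hx
      have h2 := hF a ha
      have e : 1 + ENNReal.ofReal c / p (C a) = ENNReal.ofReal (1 + c / p.real (C a)) := by
        rw [ENNReal.ofReal_add zero_le_one (by positivity), ENNReal.ofReal_one,
          ENNReal.ofReal_div_of_pos h2, Measure.real, ENNReal.ofReal_toReal (measure_ne_top _ _)]
      rw [e, ← ENNReal.ofReal_pow (by positivity)]
      exact ENNReal.ofReal_le_ofReal (exp_le_likelihood_ratio h0 h1 h2 hx.1)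
  have hqtot : Measure.pi (fun _ : Fin n => q) Set.univ = ENNReal.ofReal ((1 + c) ^ n) := by
    rw [Measure.pi_univ, ENNReal.ofReal_pow (by positivity), ENNReal.ofReal_add zero_le_one hc0]
    simp [hq]
  have hfin : ENNReal.ofReal (Real.exp (2 * n * s ^ 2) * (1 + c) ^ n)
      * Measure.pi (fun _ : Fin n => p) (⋃ a ∈ J', X a) ≤ ENNReal.ofReal ((1 + c) ^ n) := by
    calc _ ≤ ENNReal.ofReal (Real.exp (2 * n * s ^ 2) * (1 + c) ^ n)
          * ∑ a ∈ J', Measure.pi (fun _ : Fin n => p) (A a) := by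
          gcongr
          exact (measure_mono hcover).trans (measure_biUnion_finset_le _ _)
      _ ≤ ∑ a ∈ J', Measure.pi (fun _ : Fin n => q) (A a) := by
          rw [Finset.mul_sum]
          exact Finset.sum_le_sum hkey
      _ = Measure.pi (fun _ : Fin n => q) (⋃ a ∈ J', A a) :=
          (measure_biUnion_finset hdisj fun a _ => hAm a).symm
      _ ≤ _ := (measure_mono (Set.subset_univ _)).trans_eq hqtot
  have hpos : 0 < Real.exp (2 * n * s ^ 2) * (1 + c) ^ n := by positivity
  rw [mul_comm, ← ENNReal.le_div_iff_mul_le (Or.inl (by simpa using hpos))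
    (Or.inl ENNReal.ofReal_ne_top), ← ENNReal.ofReal_div_of_pos hpos] at hfin
  refine hfin.trans_eq (congrArg _ ?_)
  rw [Real.exp_neg]
  field_simp

lemma eventually_empCDF_eq {n : ℕ} (x : Fin n → ℝ) (a : ℝ) :
    ∀ᶠ b in nhdsWithin a (Set.Ioi a), empCDF x b = empCDF x a := by
  have : ∀ i, ∀ᶠ b in nhdsWithin a (Set.Ioi a), x i ≤ b ↔ x i ≤ a := by
    intro i
    by_cases h : x i ≤ a
    · filter_upwards [self_mem_nhdsWithin] with b hb
      exact iff_of_true (h.trans (le_of_lt hb)) h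
    · filter_upwards [mem_nhdsWithin_of_mem_nhds (Iio_mem_nhds (not_le.1 h))] with b hb
      exact iff_of_false (not_le.2 hb) h
  filter_upwards [Filter.eventually_all.2 this] with b hb
  simp only [empCDF, hb]

lemma exists_rat_lt_abs_empCDF_sub {n : ℕ} (p : Measure ℝ) [IsProbabilityMeasure p]
    (x : Fin n → ℝ) {s a : ℝ} (h : s < |empCDF x a - cdfOf p a|) :
    ∃ r : ℚ, s < |empCDF x r - cdfOf p r| := by
  have hcdf : cdfOf p = ProbabilityTheory.cdf p := by
    ext b
    rw [ProbabilityTheory.cdf_eq_real]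
    rfl
  have hF : Filter.Tendsto (cdfOf p) (nhdsWithin a (Set.Ioi a)) (nhds (cdfOf p a)) := by
    rw [hcdf]
    exact ((ProbabilityTheory.cdf p).right_continuous a).mono_left
      (nhdsWithin_mono a Set.Ioi_subset_Ici_self)
  have hev : ∀ᶠ b in nhdsWithin a (Set.Ioi a), s < |empCDF x b - cdfOf p b| := by
    filter_upwards [eventually_empCDF_eq x a, (hF.const_sub (empCDF x a)).abs.eventually_const_lt h]
      with b hb hb'
    rwa [hb]
  obtain ⟨u, hu, hsub⟩ := mem_nhdsGT_iff_exists_Ioo_subset.1 hev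
  obtain ⟨r, hr1, hr2⟩ := exists_rat_btwn (Set.mem_Ioi.1 hu)
  exact ⟨r, hsub ⟨hr1, hr2⟩⟩

lemma measure_exists_finset_abs_empCDF_sub_le (p : Measure ℝ) [IsProbabilityMeasure p] (n : ℕ)
    {s : ℝ} (h0 : 0 ≤ s) (J : Finset ℚ) :
    Measure.pi (fun _ : Fin n => p) {x | ∃ r ∈ J, s ≤ |empCDF x r - cdfOf p r|}
      ≤ ENNReal.ofReal (2 * Real.exp (-(2 * n * s ^ 2))) := by
  rcases Nat.eq_zero_or_pos n with rfl | hn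
  · refine prob_le_one.trans ?_
    simp
  have hn' : (0 : ℝ) < n := by exact_mod_cast hn
  have hup := measure_exists_count_ge_le p
    (C := fun r : ℚᵒᵈ => Set.Iic ((OrderDual.ofDual r : ℚ) : ℝ))
    (fun a b hab => Set.Iic_subset_Iic.2 (Rat.cast_le.2 hab)) (fun _ => measurableSet_Iic)
    (J.map OrderDual.toDual.toEmbedding) n h0
  have hdown := measure_exists_count_ge_le p (C := fun r : ℚ => Set.Ioi (r : ℝ))
    (fun a b hab => Set.Ioi_subset_Ioi (Rat.cast_le.2 hab)) (fun _ => measurableSet_Ioi) J n h0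
  rw [two_mul, ENNReal.ofReal_add (by positivity) (by positivity)]
  refine le_trans (measure_mono ?_) ((measure_union_le _ _).trans (add_le_add hup hdown))
  rintro x ⟨r, hr, hx⟩
  have hcard : empCDF x r * n = (Finset.univ.filter fun i => x i ≤ (r : ℝ)).card := by
    unfold empCDF
    field_simp
  rcases le_abs.1 hx with h | h
  · refine Or.inl ⟨OrderDual.toDual r, by simpa using hr, ?_⟩
    simp only [OrderDual.ofDual_toDual, Set.mem_Iic]
    rw [← hcard, mul_comm]
    have : p.real (Set.Iic (r : ℝ)) = cdfOf p r := rfl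
    rw [this]
    gcongr
    linarith
  · refine Or.inr ⟨r, hr, ?_⟩
    have h1 : p.real (Set.Ioi (r : ℝ)) = 1 - cdfOf p r := by
      rw [← Set.compl_Iic, probReal_compl_eq_one_sub measurableSet_Iic]
      rfl
    have h2 : ((Finset.univ.filter fun i => x i ∈ Set.Ioi (r : ℝ)).card : ℝ)
        = n - empCDF x r * n := by
      have := Finset.card_filter_add_card_filter_not (s := Finset.univ)
        (fun i => x i ≤ (r : ℝ))
      simp only [not_le, Finset.card_univ, Fintype.card_fin] at this
      rw [hcard, eq_sub_iff_add_eq', ← Nat.cast_add]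
      exact_mod_cast this
    rw [h1]
    refine le_of_le_of_eq (b := n - empCDF x r * n) (by nlinarith) ?_
    convert h2.symm

/-- Two-sided Dvoretzky–Kiefer–Wolfowitz–Massart inequality. -/
theorem measure_exists_abs_empCDF_sub_le (p : Measure ℝ) [IsProbabilityMeasure p] (n : ℕ)
    {s : ℝ} (h0 : 0 ≤ s) :
    Measure.pi (fun _ : Fin n => p) {x | ∃ a, s < |empCDF x a - cdfOf p a|}
      ≤ ENNReal.ofReal (2 * Real.exp (-(2 * n * s ^ 2))) := by
  have hsub : {x : Fin n → ℝ | ∃ a, s < |empCDF x a - cdfOf p a|}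
      ⊆ ⋃ J : Finset ℚ, {x | ∃ r ∈ J, s ≤ |empCDF x r - cdfOf p r|} := by
    rintro x ⟨a, ha⟩
    obtain ⟨r, hr⟩ := exists_rat_lt_abs_empCDF_sub p x ha
    exact Set.mem_iUnion.2 ⟨{r}, r, by simp, hr.le⟩
  refine (measure_mono hsub).trans ?_
  rw [Directed.measure_iUnion]
  · exact iSup_le fun J => measure_exists_finset_abs_empCDF_sub_le p n h0 J
  · exact directed_of_isDirected_le fun J J' hJ x ⟨r, hr, hx⟩ => ⟨r, Finset.mem_of_subset hJ hr, hx⟩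

/-- Two-sided Dvoretzky–Kiefer–Wolfowitz–Massart inequality, with a non-strict threshold. -/
theorem measure_forall_exists_abs_empCDF_sub_le (p : Measure ℝ) [IsProbabilityMeasure p] (n : ℕ)
    {s : ℝ} (hs : 0 < s) :
    Measure.pi (fun _ : Fin n => p) {x | ∀ s' < s, ∃ a, s' < |empCDF x a - cdfOf p a|}
      ≤ ENNReal.ofReal (2 * Real.exp (-(2 * n * s ^ 2))) := by
  have hlim : Filter.Tendsto (fun u : ℝ => ENNReal.ofReal (2 * Real.exp (-(2 * n * u ^ 2))))
      (nhdsWithin s (Set.Iio s)) (nhds (ENNReal.ofReal (2 * Real.exp (-(2 * n * s ^ 2))))) := by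
    refine ENNReal.tendsto_ofReal (Filter.Tendsto.mono_left ?_ nhdsWithin_le_nhds)
    exact Continuous.tendsto (by fun_prop) s
  refine ge_of_tendsto hlim ?_
  filter_upwards [Ioo_mem_nhdsLT hs] with u hu
  exact (measure_mono fun x (hx : ∀ s' < s, ∃ a, s' < |empCDF x a - cdfOf p a|) => hx u hu.2).trans
    (measure_exists_abs_empCDF_sub_le p n hu.1.le)

lemma empCDF_mem_Icc {n : ℕ} (x : Fin n → ℝ) (a : ℝ) : empCDF x a ∈ Set.Icc (0 : ℝ) 1 := by
  refine ⟨by unfold empCDF; positivity, div_le_one_of_le₀ ?_ (Nat.cast_nonneg _)⟩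
  exact_mod_cast (Finset.card_filter_le _ _).trans_eq (by simp)

lemma cdfOf_mem_Icc (p : Measure ℝ) [IsProbabilityMeasure p] (a : ℝ) :
    cdfOf p a ∈ Set.Icc (0 : ℝ) 1 :=
  ⟨measureReal_nonneg, measureReal_le_one⟩

lemma abs_sub_le_one_of_mem_Icc {u v : ℝ} (hu : u ∈ Set.Icc (0 : ℝ) 1)
    (hv : v ∈ Set.Icc (0 : ℝ) 1) : |u - v| ≤ 1 :=
  abs_sub_le_iff.2 ⟨by linarith [hu.2, hv.1], by linarith [hu.1, hv.2]⟩

lemma abs_empCDF_sub_le_ksDistSeq {n : ℕ} (x y : Fin n → ℝ) (a : ℝ) :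
    |empCDF x a - empCDF y a| ≤ ksDistSeq x y :=
  le_ciSup (f := fun a => |empCDF x a - empCDF y a|)
    ⟨1, Set.forall_mem_range.2 fun a =>
      abs_sub_le_one_of_mem_Icc (empCDF_mem_Icc x a) (empCDF_mem_Icc y a)⟩ a

lemma abs_cdfOf_sub_le_ksDist (p q : Measure ℝ) [IsProbabilityMeasure p] [IsProbabilityMeasure q]
    (a : ℝ) : |cdfOf p a - cdfOf q a| ≤ ksDist p q :=
  le_ciSup (f := fun a => |cdfOf p a - cdfOf q a|)
    ⟨1, Set.forall_mem_range.2 fun a =>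
      abs_sub_le_one_of_mem_Icc (cdfOf_mem_Icc p a) (cdfOf_mem_Icc q a)⟩ a

lemma ksDist_mem_Icc (p q : Measure ℝ) [IsProbabilityMeasure p] [IsProbabilityMeasure q] :
    ksDist p q ∈ Set.Icc (0 : ℝ) 1 :=
  ⟨Real.iSup_nonneg fun _ => abs_nonneg _,
    ciSup_le fun a => abs_sub_le_one_of_mem_Icc (cdfOf_mem_Icc p a) (cdfOf_mem_Icc q a)⟩

lemma ksDist_le_add {n : ℕ} {p q : Measure ℝ} {x y : Fin n → ℝ} {u v : ℝ}
    (hx : ∀ a, |empCDF x a - cdfOf p a| ≤ u) (hy : ∀ a, |empCDF y a - cdfOf q a| ≤ v) :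
    ksDist p q ≤ ksDistSeq x y + u + v :=
  ciSup_le fun a => by
    have h1 := abs_empCDF_sub_le_ksDistSeq x y a
    have h2 := hx a
    have h3 := hy a
    rw [abs_le] at *
    constructor <;> linarith

lemma ksDistSeq_le_add {n : ℕ} {p q : Measure ℝ} [IsProbabilityMeasure p] [IsProbabilityMeasure q]
    {x y : Fin n → ℝ} {u v : ℝ}
    (hx : ∀ a, |empCDF x a - cdfOf p a| ≤ u) (hy : ∀ a, |empCDF y a - cdfOf q a| ≤ v) :
    ksDistSeq x y ≤ ksDist p q + u + v :=
  ciSup_le fun a => by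
    have h1 := abs_cdfOf_sub_le_ksDist p q a
    have h2 := hx a
    have h3 := hy a
    rw [abs_le] at *
    constructor <;> linarith

/-- Proposition: the KS distance satisfies Assumption 1.
With `K` clusters of distributions on ℝ, `d_L` the largest intra-cluster KS diameter,
`d_H` the smallest inter-cluster KS distance, `d_L < d_H`, `Δ = d_H − d_L`, for any
`d_th ∈ (d_L, d_H)` and independent sequences of `n` i.i.d. samples `x ∼ p ∈ P_k`,
`x' ∼ p' ∈ P_k`, `x'' ∼ p'' ∈ P_{k'}` with `k ≠ k'`, the three concentration bounds hold
with `b = min{(d_th − d_L)²/2, (d_H − d_th)²/2, Δ²/8}`. -/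
theorem stmt8 {K : ℕ} (P : Fin K → Set (Measure ℝ))
    (hP : ∀ k, ∀ p ∈ P k, IsProbabilityMeasure p)
    (dL dH : ℝ)
    (hdL : sSup {r : ℝ | ∃ k : Fin K, ∃ p ∈ P k, ∃ q ∈ P k, r = ksDist p q} = dL)
    (hdH : sInf {r : ℝ | ∃ k k' : Fin K, k ≠ k' ∧ ∃ p ∈ P k, ∃ q ∈ P k', r = ksDist p q} = dH)
    (hLH : dL < dH)
    (dth : ℝ) (hth₁ : dL < dth) (hth₂ : dth < dH)
    (n : ℕ) (k k' : Fin K) (hkk : k ≠ k')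
    (p p' p'' : Measure ℝ) (hp : p ∈ P k) (hp' : p' ∈ P k) (hp'' : p'' ∈ P k')
    (b : ℝ)
    (hb : b = min (min ((dth - dL) ^ 2 / 2) ((dH - dth) ^ 2 / 2)) ((dH - dL) ^ 2 / 8)) :
    ((Measure.pi fun _ : Fin n => p).prod
        ((Measure.pi fun _ : Fin n => p').prod (Measure.pi fun _ : Fin n => p'')))
        {ω : (Fin n → ℝ) × ((Fin n → ℝ) × (Fin n → ℝ)) | ksDistSeq ω.1 ω.2.2 ≤ dth}
      ≤ ENNReal.ofReal (4 * Real.exp (-(b * (n : ℝ)))) ∧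
    ((Measure.pi fun _ : Fin n => p).prod
        ((Measure.pi fun _ : Fin n => p').prod (Measure.pi fun _ : Fin n => p'')))
        {ω : (Fin n → ℝ) × ((Fin n → ℝ) × (Fin n → ℝ)) | ksDistSeq ω.1 ω.2.1 > dth}
      ≤ ENNReal.ofReal (4 * Real.exp (-(b * (n : ℝ)))) ∧
    ((Measure.pi fun _ : Fin n => p).prod
        ((Measure.pi fun _ : Fin n => p').prod (Measure.pi fun _ : Fin n => p'')))
        {ω : (Fin n → ℝ) × ((Fin n → ℝ) × (Fin n → ℝ)) |
          ksDistSeq ω.1 ω.2.1 ≥ ksDistSeq ω.1 ω.2.2}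
      ≤ ENNReal.ofReal (6 * Real.exp (-(b * (n : ℝ)))) := by
  have := hP k p hp
  have := hP k p' hp'
  have := hP k' p'' hp''
  have hL : ksDist p p' ≤ dL := by
    rw [← hdL]
    refine le_csSup ⟨1, ?_⟩ ⟨k, p, hp, p', hp', rfl⟩
    rintro r ⟨j, q, hq, q', hq', rfl⟩
    have := hP j q hq
    have := hP j q' hq'
    exact (ksDist_mem_Icc q q').2
  have hH : dH ≤ ksDist p p'' := by
    rw [← hdH]
    refine csInf_le ⟨0, ?_⟩ ⟨k, k', hkk, p, hp, p'', hp'', rfl⟩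
    rintro r ⟨j, j', -, q, hq, q', hq', rfl⟩
    have := hP j q hq
    have := hP j' q' hq'
    exact (ksDist_mem_Icc q q').1
  set G : ℝ → Measure ℝ → Set (Fin n → ℝ) := fun s q =>
    {x | ∀ s' < s, ∃ a, s' < |empCDF x a - cdfOf q a|} with hG
  have hGnot : ∀ {s q x}, x ∉ G s q → ∃ s' < s, ∀ a, |empCDF x a - cdfOf q a| ≤ s' := by
    intro s q x hx
    simpa [hG] using hx
  have hGle : ∀ (q : Measure ℝ) [IsProbabilityMeasure q] {s : ℝ}, 0 < s → b ≤ 2 * s ^ 2 →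
      Measure.pi (fun _ : Fin n => q) (G s q) ≤ ENNReal.ofReal (2 * Real.exp (-(b * n))) := by
    intro q _ s hs hbs
    refine (measure_forall_exists_abs_empCDF_sub_le q n hs).trans (ENNReal.ofReal_le_ofReal ?_)
    have : b * n ≤ 2 * s ^ 2 * n := by gcongr
    exact mul_le_mul_of_nonneg_left (Real.exp_le_exp.2 (by linarith)) zero_le_two
  set μ := (Measure.pi fun _ : Fin n => p).prod
    ((Measure.pi fun _ : Fin n => p').prod (Measure.pi fun _ : Fin n => p'')) with hμ
  have m1 : ∀ S, μ {ω | ω.1 ∈ S} = Measure.pi (fun _ : Fin n => p) S := fun S => by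
    have : {ω : (Fin n → ℝ) × ((Fin n → ℝ) × (Fin n → ℝ)) | ω.1 ∈ S} = S ×ˢ Set.univ := by
      ext; simp
    rw [this, hμ, Measure.prod_prod, measure_univ, mul_one]
  have m2 : ∀ S, μ {ω | ω.2.1 ∈ S} = Measure.pi (fun _ : Fin n => p') S := fun S => by
    have : {ω : (Fin n → ℝ) × ((Fin n → ℝ) × (Fin n → ℝ)) | ω.2.1 ∈ S}
        = Set.univ ×ˢ (S ×ˢ Set.univ) := by
      ext; simp
    rw [this, hμ, Measure.prod_prod, Measure.prod_prod, measure_univ, measure_univ, mul_one,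
      one_mul]
  have m3 : ∀ S, μ {ω | ω.2.2 ∈ S} = Measure.pi (fun _ : Fin n => p'') S := fun S => by
    have : {ω : (Fin n → ℝ) × ((Fin n → ℝ) × (Fin n → ℝ)) | ω.2.2 ∈ S}
        = Set.univ ×ˢ (Set.univ ×ˢ S) := by
      ext; simp
    rw [this, hμ, Measure.prod_prod, Measure.prod_prod, measure_univ, measure_univ, one_mul,
      one_mul]
  have e4 : ENNReal.ofReal (4 * Real.exp (-(b * n))) = ENNReal.ofReal (2 * Real.exp (-(b * n)))
      + ENNReal.ofReal (2 * Real.exp (-(b * n))) := by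
    rw [← ENNReal.ofReal_add (by positivity) (by positivity)]
    ring_nf
  have e6 : ENNReal.ofReal (6 * Real.exp (-(b * n))) = ENNReal.ofReal (2 * Real.exp (-(b * n)))
      + (ENNReal.ofReal (2 * Real.exp (-(b * n))) + ENNReal.ofReal (2 * Real.exp (-(b * n)))) := by
    rw [← ENNReal.ofReal_add (by positivity) (by positivity),
      ← ENNReal.ofReal_add (by positivity) (by positivity)]
    ring_nf
  have b1 : b ≤ 2 * ((dth - dL) / 2) ^ 2 := by
    rw [hb]
    exact ((min_le_left _ _).trans (min_le_left _ _)).trans (by linarith)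
  have b2 : b ≤ 2 * ((dH - dth) / 2) ^ 2 := by
    rw [hb]
    exact ((min_le_left _ _).trans (min_le_right _ _)).trans (by linarith)
  have b3 : b ≤ 2 * ((dH - dL) / 4) ^ 2 := by
    rw [hb]
    exact (min_le_right _ _).trans (by linarith)
  refine ⟨?_, ?_, ?_⟩
  · have hs : 0 < (dH - dth) / 2 := by linarith
    rw [e4]
    refine le_trans (measure_mono ?_) ((measure_union_le _ _).trans
      (add_le_add ((m1 _).trans_le (hGle p hs b2)) ((m3 _).trans_le (hGle p'' hs b2))))
    intro ω hω
    by_contra h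
    obtain ⟨hx, hz⟩ := not_or.1 h
    obtain ⟨u, hu, hx⟩ := hGnot hx
    obtain ⟨w, hw, hz⟩ := hGnot hz
    have h1 := ksDist_le_add hx hz
    have h2 : ksDistSeq ω.1 ω.2.2 ≤ dth := hω
    linarith
  · have hs : 0 < (dth - dL) / 2 := by linarith
    rw [e4]
    refine le_trans (measure_mono ?_) ((measure_union_le _ _).trans
      (add_le_add ((m1 _).trans_le (hGle p hs b1)) ((m2 _).trans_le (hGle p' hs b1))))
    intro ω hω
    by_contra h
    obtain ⟨hx, hy⟩ := not_or.1 h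
    obtain ⟨u, hu, hx⟩ := hGnot hx
    obtain ⟨v, hv, hy⟩ := hGnot hy
    have h1 := ksDistSeq_le_add hx hy
    have h2 : dth < ksDistSeq ω.1 ω.2.1 := hω
    linarith
  · have hs : 0 < (dH - dL) / 4 := by linarith
    rw [e6]
    refine le_trans (measure_mono ?_) ((measure_union_le _ _).trans (add_le_add
      ((m1 _).trans_le (hGle p hs b3)) ((measure_union_le _ _).trans
        (add_le_add ((m2 _).trans_le (hGle p' hs b3)) ((m3 _).trans_le (hGle p'' hs b3))))))
    intro ω hω
    by_contra h
    obtain ⟨hx, h⟩ := not_or.1 h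
    obtain ⟨hy, hz⟩ := not_or.1 h
    obtain ⟨u, hu, hx⟩ := hGnot hx
    obtain ⟨v, hv, hy⟩ := hGnot hy
    obtain ⟨w, hw, hz⟩ := hGnot hz
    have h1 := ksDistSeq_le_add hx hy
    have h2 := ksDist_le_add hx hz
    have h3 : ksDistSeq ω.1 ω.2.2 ≤ ksDistSeq ω.1 ω.2.1 := hω
    linarith
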